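/- The Gibbons–Hawking decomposition of the hyperKähler 2-forms holds: at every nonzero q ∈ ℝ⁴, γ₁ = η_q ∧ (dμ₁)_q − ‖q‖⁻²·(dμ₂)_q ∧ (dμ₃)_q, γ₂ = η_q ∧ (dμ₂)_q − ‖q‖⁻²·(dμ₃)_q ∧ (dμ₁)_q, and γ₃ = η_q ∧ (dμ₃)_q − ‖q‖⁻²·(dμ₁)_q ∧ (dμ₂)_q. (Here ‖q‖⁻² = f(μ(q)) for f(u) = 1/(2‖u‖), since ‖μ(q)‖ = ‖q‖²/2.) -/

import Mathlib

noncomputable section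

/-- The imaginary unit `i` in the real quaternions. -/
def qI : Quaternion ℝ := ⟨0, 1, 0, 0⟩

/-- The Hopf moment map `μ(q) = (1/2)·(conj q)·i·q`. -/
def hopfMu (q : Quaternion ℝ) : Quaternion ℝ := (1 / 2 : ℝ) • (star q * qI * q)

/-- The components `μ₁, μ₂, μ₃` of the Hopf moment map along `i`, `j`, `k`. -/
def mu1 (q : Quaternion ℝ) : ℝ := (hopfMu q).imI
def mu2 (q : Quaternion ℝ) : ℝ := (hopfMu q).imJ
def mu3 (q : Quaternion ℝ) : ℝ := (hopfMu q).imK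

/-- Coordinates on `ℝ⁴ ≅ ℍ` via `(x₁,x₂,x₃,x₄) ↦ x₁ + x₂·i + x₃·j − x₄·k`:
the dual standard basis `dx₁, dx₂, dx₃, dx₄`. -/
def dx1 (v : Quaternion ℝ) : ℝ := v.re
def dx2 (v : Quaternion ℝ) : ℝ := v.imI
def dx3 (v : Quaternion ℝ) : ℝ := v.imJ
def dx4 (v : Quaternion ℝ) : ℝ := -v.imK

/-- `γ₁ = dx₁∧dx₂ + dx₃∧dx₄`. -/
def gamma1 (v w : Quaternion ℝ) : ℝ :=
  (dx1 v * dx2 w - dx2 v * dx1 w) + (dx3 v * dx4 w - dx4 v * dx3 w)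

/-- `γ₂ = dx₁∧dx₃ + dx₄∧dx₂`. -/
def gamma2 (v w : Quaternion ℝ) : ℝ :=
  (dx1 v * dx3 w - dx3 v * dx1 w) + (dx4 v * dx2 w - dx2 v * dx4 w)

/-- `γ₃ = −dx₁∧dx₄ − dx₂∧dx₃`. -/
def gamma3 (v w : Quaternion ℝ) : ℝ :=
  -(dx1 v * dx4 w - dx4 v * dx1 w) - (dx2 v * dx3 w - dx3 v * dx2 w)

/-- The connection 1-form `η_q = ‖q‖⁻²(x₂dx₁ − x₁dx₂ − x₄dx₃ + x₃dx₄)`. -/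
def eta (q v : Quaternion ℝ) : ℝ :=
  (‖q‖ ^ 2)⁻¹ * (dx2 q * dx1 v - dx1 q * dx2 v - dx4 q * dx3 v + dx3 q * dx4 v)

def cRe : Quaternion ℝ →L[ℝ] ℝ :=
  LinearMap.toContinuousLinearMap
    { toFun := fun v => v.re, map_add' := fun _ _ => rfl, map_smul' := fun _ _ => by simp }
def cI : Quaternion ℝ →L[ℝ] ℝ :=
  LinearMap.toContinuousLinearMap
    { toFun := fun v => v.imI, map_add' := fun _ _ => rfl, map_smul' := fun _ _ => by simp }
def cJ : Quaternion ℝ →L[ℝ] ℝ :=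
  LinearMap.toContinuousLinearMap
    { toFun := fun v => v.imJ, map_add' := fun _ _ => rfl, map_smul' := fun _ _ => by simp }
def cK : Quaternion ℝ →L[ℝ] ℝ :=
  LinearMap.toContinuousLinearMap
    { toFun := fun v => v.imK, map_add' := fun _ _ => rfl, map_smul' := fun _ _ => by simp }

lemma cRe_apply (v : Quaternion ℝ) : cRe v = v.re := rfl
lemma cI_apply (v : Quaternion ℝ) : cI v = v.imI := rfl
lemma cJ_apply (v : Quaternion ℝ) : cJ v = v.imJ := rfl
lemma cK_apply (v : Quaternion ℝ) : cK v = v.imK := rfl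

lemma qI_re : qI.re = 0 := rfl
lemma qI_imI : qI.imI = 1 := rfl
lemma qI_imJ : qI.imJ = 0 := rfl
lemma qI_imK : qI.imK = 0 := rfl

lemma mu1_eq : mu1 = fun q => (1 / 2 : ℝ) * (cRe q * cRe q + cI q * cI q - cJ q * cJ q
    - cK q * cK q) := by
  funext q
  simp [mu1, hopfMu, qI_re, qI_imI, qI_imJ, qI_imK, cRe_apply, cI_apply, cJ_apply, cK_apply]
  ring

lemma mu2_eq : mu2 = fun q => cI q * cJ q - cRe q * cK q := by
  funext q
  simp [mu2, hopfMu, qI_re, qI_imI, qI_imJ, qI_imK, cRe_apply, cI_apply, cJ_apply, cK_apply]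
  ring

lemma mu3_eq : mu3 = fun q => cI q * cK q + cRe q * cJ q := by
  funext q
  simp [mu3, hopfMu, qI_re, qI_imI, qI_imJ, qI_imK, cRe_apply, cI_apply, cJ_apply, cK_apply]
  ring

lemma fderiv_mu1 (q v : Quaternion ℝ) : fderiv ℝ mu1 q v =
    q.re * v.re + q.imI * v.imI - q.imJ * v.imJ - q.imK * v.imK := by
  have h1 := cRe.hasFDerivAt (x := q)
  have h2 := cI.hasFDerivAt (x := q)
  have h3 := cJ.hasFDerivAt (x := q)
  have h4 := cK.hasFDerivAt (x := q)
  have h := ((((h1.mul h1).add (h2.mul h2)).sub (h3.mul h3)).sub (h4.mul h4)).const_mul (1 / 2 : ℝ)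
  rw [mu1_eq]
  refine (congrArg (fun L => L v) h.fderiv).trans ?_
  simp [cRe_apply, cI_apply, cJ_apply, cK_apply]
  ring

lemma fderiv_mu2 (q v : Quaternion ℝ) : fderiv ℝ mu2 q v =
    q.imI * v.imJ + q.imJ * v.imI - q.re * v.imK - q.imK * v.re := by
  have h1 := cRe.hasFDerivAt (x := q)
  have h2 := cI.hasFDerivAt (x := q)
  have h3 := cJ.hasFDerivAt (x := q)
  have h4 := cK.hasFDerivAt (x := q)
  have h := (h2.mul h3).sub (h1.mul h4)
  rw [mu2_eq]
  refine (congrArg (fun L => L v) h.fderiv).trans ?_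
  simp [cRe_apply, cI_apply, cJ_apply, cK_apply]
  ring

lemma fderiv_mu3 (q v : Quaternion ℝ) : fderiv ℝ mu3 q v =
    q.imI * v.imK + q.imK * v.imI + q.re * v.imJ + q.imJ * v.re := by
  have h1 := cRe.hasFDerivAt (x := q)
  have h2 := cI.hasFDerivAt (x := q)
  have h3 := cJ.hasFDerivAt (x := q)
  have h4 := cK.hasFDerivAt (x := q)
  have h := (h2.mul h4).add (h1.mul h3)
  rw [mu3_eq]
  refine (congrArg (fun L => L v) h.fderiv).trans ?_
  simp [cRe_apply, cI_apply, cJ_apply, cK_apply]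
  ring

/-- The Gibbons–Hawking decomposition of the hyperKähler 2-forms: at every nonzero `q`,
`γ₁ = η_q ∧ dμ₁ − ‖q‖⁻²·dμ₂ ∧ dμ₃`, `γ₂ = η_q ∧ dμ₂ − ‖q‖⁻²·dμ₃ ∧ dμ₁` and
`γ₃ = η_q ∧ dμ₃ − ‖q‖⁻²·dμ₁ ∧ dμ₂`. -/
theorem gibbons_hawking_decomposition (q : Quaternion ℝ) (hq : q ≠ 0)
    (v w : Quaternion ℝ) :
    gamma1 v w = (eta q v * fderiv ℝ mu1 q w - eta q w * fderiv ℝ mu1 q v) -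
        (‖q‖ ^ 2)⁻¹ *
          (fderiv ℝ mu2 q v * fderiv ℝ mu3 q w - fderiv ℝ mu2 q w * fderiv ℝ mu3 q v) ∧
    gamma2 v w = (eta q v * fderiv ℝ mu2 q w - eta q w * fderiv ℝ mu2 q v) -
        (‖q‖ ^ 2)⁻¹ *
          (fderiv ℝ mu3 q v * fderiv ℝ mu1 q w - fderiv ℝ mu3 q w * fderiv ℝ mu1 q v) ∧
    gamma3 v w = (eta q v * fderiv ℝ mu3 q w - eta q w * fderiv ℝ mu3 q v) -
        (‖q‖ ^ 2)⁻¹ *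
          (fderiv ℝ mu1 q v * fderiv ℝ mu2 q w - fderiv ℝ mu1 q w * fderiv ℝ mu2 q v) := by
  have hn : ‖q‖ ^ 2 = q.re ^ 2 + q.imI ^ 2 + q.imJ ^ 2 + q.imK ^ 2 := by
    rw [pow_two, ← Quaternion.normSq_eq_norm_mul_self, Quaternion.normSq_def']
  have h0 : q.re ^ 2 + q.imI ^ 2 + q.imJ ^ 2 + q.imK ^ 2 ≠ 0 := by
    rw [← hn]
    exact pow_ne_zero 2 (norm_ne_zero_iff.mpr hq)
  simp only [fderiv_mu1, fderiv_mu2, fderiv_mu3, eta, gamma1, gamma2, gamma3, dx1, dx2, dx3, dx4,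
    hn]
  refine ⟨?_, ?_, ?_⟩ <;> field_simp <;> ring
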